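/- Let n, l ∈ ℕ, let λ be a partition of n with at most l rows (λ'_1 ≤ l), let S be a (finite) standard Young tableau of shape λ, and let T ∈ SYT((∞^l)). Then jdt(S ◁ T) = jdt(S) ◁ T, where on the left jdt is the jeu de taquin map on SYT((∞^l)), on the right jdt(S) is the finite jeu de taquin of S, and ◁ denotes the left smash of a finite tableau with an infinite tableau. -/

import Mathlib

open scoped Classical

/-- A 0-based box `(i, j)` belongs to the infinite shape with `l` rows
(`l = ⊤` gives the shape `(∞^∞)`, `l = (l₀ : ℕ∞)` gives `(∞^l₀)`).
Throughout, boxes are 0-based: the paper's box `(i, j)` (with row `i ≥ 1` and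
column `j ≥ 1`) corresponds to `(i - 1, j - 1)`. -/
def Box (l : ℕ∞) (b : ℕ × ℕ) : Prop := (b.1 : ℕ∞) < l

/-- `T` is an infinite standard Young tableau of the shape given by `Box l`:
entries are positive integers on the shape (and the junk value `0` off the shape),
`T` is a bijection from the boxes of the shape onto the positive integers, and
`T` is strictly increasing along rows and columns. -/
structure IsSYT (l : ℕ∞) (T : ℕ × ℕ → ℕ) : Prop where
  zero_outside : ∀ b : ℕ × ℕ, ¬ Box l b → T b = 0
  pos : ∀ b : ℕ × ℕ, Box l b → 0 < T b
  inj : ∀ b c : ℕ × ℕ, Box l b → Box l c → T b = T c → b = c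
  surj : ∀ n : ℕ, 0 < n → ∃ b : ℕ × ℕ, Box l b ∧ T b = n
  row_lt : ∀ b : ℕ × ℕ, Box l b → T b < T (b.1, b.2 + 1)
  col_lt : ∀ b : ℕ × ℕ, Box l (b.1 + 1, b.2) → T b < T (b.1 + 1, b.2)

/-- The sliding path of the filling `T` inside the set `D` of boxes, started at the
box `c`: at each step the empty box moves to whichever of the boxes directly below
or directly to the right (among those belonging to `D`) carries the smaller entry;
if neither belongs to `D`, the path stays put (it has terminated). -/
noncomputable def slideFrom (D : ℕ × ℕ → Prop) (T : ℕ × ℕ → ℕ) (c : ℕ × ℕ) : ℕ → ℕ × ℕ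
  | 0 => c
  | n + 1 =>
      let b := slideFrom D T c n
      if D (b.1 + 1, b.2) ∧ D (b.1, b.2 + 1) then
        (if T (b.1 + 1, b.2) < T (b.1, b.2 + 1) then (b.1 + 1, b.2) else (b.1, b.2 + 1))
      else if D (b.1 + 1, b.2) then (b.1 + 1, b.2)
      else if D (b.1, b.2 + 1) then (b.1, b.2 + 1)
      else b

/-- The sliding path `p(T)`, 0-indexed: `slide D T n` is the paper's `p_{n+1}(T)`;
it lies on the antidiagonal `i + j = n` as long as the path has not terminated. -/
noncomputable def slide (D : ℕ × ℕ → Prop) (T : ℕ × ℕ → ℕ) : ℕ → ℕ × ℕ :=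
  slideFrom D T (0, 0)

/-- Jeu de taquin on the set of boxes `D`: the entry `1` in the box `(0,0)` is
deleted, entries slide backwards along the sliding path, and every entry is
decremented by `1`.  A box `b` lies on the sliding path iff
`slide D T (b.1 + b.2) = b`; if moreover the path terminates at `b` (which is only
possible for finite tableaux) the box `b` is vacated (junk value `0`). -/
noncomputable def jdt (D : ℕ × ℕ → Prop) (T : ℕ × ℕ → ℕ) : ℕ × ℕ → ℕ := fun b =>
  if slide D T (b.1 + b.2) = b then
    (if slide D T (b.1 + b.2 + 1) = b then 0
     else T (slide D T (b.1 + b.2 + 1)) - 1)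
  else T b - 1

/-- A 0-based box of the Young diagram of the partition with row lengths `lam`. -/
def YBox (lam : ℕ → ℕ) (b : ℕ × ℕ) : Prop := b.2 < lam b.1

/-- `lam : ℕ → ℕ` (0-based row lengths) is a partition of `n`. -/
structure IsPartition (lam : ℕ → ℕ) (n : ℕ) : Prop where
  antitone : ∀ i : ℕ, lam (i + 1) ≤ lam i
  finite : {b : ℕ × ℕ | YBox lam b}.Finite
  card : {b : ℕ × ℕ | YBox lam b}.ncard = n

/-- `S` is a (finite) standard Young tableau of shape `lam` with `n` boxes:
a filling of the diagram of `lam` by `1, …, n` (with junk value `0` off the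
diagram), strictly increasing along rows and columns. -/
structure IsFinSYT (lam : ℕ → ℕ) (n : ℕ) (S : ℕ × ℕ → ℕ) : Prop where
  zero_outside : ∀ b : ℕ × ℕ, ¬ YBox lam b → S b = 0
  lb : ∀ b : ℕ × ℕ, YBox lam b → 1 ≤ S b
  ub : ∀ b : ℕ × ℕ, YBox lam b → S b ≤ n
  inj : ∀ b c : ℕ × ℕ, YBox lam b → YBox lam c → S b = S c → b = c
  surj : ∀ m : ℕ, 1 ≤ m → m ≤ n → ∃ b : ℕ × ℕ, YBox lam b ∧ S b = m
  row_lt : ∀ b : ℕ × ℕ, YBox lam (b.1, b.2 + 1) → S b < S (b.1, b.2 + 1)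
  col_lt : ∀ b : ℕ × ℕ, YBox lam (b.1 + 1, b.2) → S b < S (b.1 + 1, b.2)

/-- Left smash `S ◁ T` of a finite standard Young tableau `S` of shape `lam` (a
partition of `n`) with an infinite tableau `T` of shape `(∞^l)`: row `i` of the
result starts with row `i` of `S`, followed by row `i` of `T` incremented by `n`. -/
noncomputable def smashFin (l : ℕ∞) (n : ℕ) (lam : ℕ → ℕ) (S T : ℕ × ℕ → ℕ) :
    ℕ × ℕ → ℕ := fun b =>
  if Box l b then (if b.2 < lam b.1 then S b else T (b.1, b.2 - lam b.1) + n) else 0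

theorem slide_zero' (D : ℕ × ℕ → Prop) (T : ℕ × ℕ → ℕ) : slide D T 0 = (0, 0) := rfl

theorem slide_succ' (D : ℕ × ℕ → Prop) (T : ℕ × ℕ → ℕ) (m i j : ℕ) (h : slide D T m = (i, j)) :
    slide D T (m + 1) =
      if D (i + 1, j) ∧ D (i, j + 1) then
        (if T (i + 1, j) < T (i, j + 1) then (i + 1, j) else (i, j + 1))
      else if D (i + 1, j) then (i + 1, j)
      else if D (i, j + 1) then (i, j + 1)
      else (i, j) := by
  unfold slide at *
  rw [slideFrom]
  simp only [h]

theorem box_iff' (l i j : ℕ) : Box (l : ℕ∞) (i, j) ↔ i < l := by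
  simp [Box]

theorem ybox_iff' (lam : ℕ → ℕ) (i j : ℕ) : YBox lam (i, j) ↔ j < lam i := Iff.rfl

theorem syt_mono (l : ℕ) (T : ℕ × ℕ → ℕ) (hT : IsSYT (l : ℕ∞) T) (i : ℕ) (hi : i < l) (a b : ℕ)
    (h : a ≤ b) : T (i, a) ≤ T (i, b) := by
  induction b, h using Nat.le_induction with
  | base => exact le_rfl
  | succ b _ ih => exact ih.trans (hT.row_lt (i, b) ((box_iff' _ _ _).2 hi)).le

theorem path_struct (n l : ℕ) (hn : 1 ≤ n) (lam : ℕ → ℕ)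
    (hpart : IsPartition lam n) (hrows : ∀ i : ℕ, l ≤ i → lam i = 0)
    (S : ℕ × ℕ → ℕ) (hS : IsFinSYT lam n S)
    (T : ℕ × ℕ → ℕ) (hT : IsSYT (l : ℕ∞) T) :
    ∃ r c : ℕ, r + c < n ∧ r < l ∧ c + 1 = lam r ∧ lam (r + 1) ≤ c ∧
      (∀ m ≤ r + c, slide (Box (l : ℕ∞)) (smashFin (l : ℕ∞) n lam S T) m = slide (YBox lam) S m ∧
        YBox lam (slide (YBox lam) S m) ∧
        (slide (YBox lam) S m).1 + (slide (YBox lam) S m).2 = m) ∧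
      (∀ t, slide (YBox lam) S (r + c + t) = (r, c)) ∧
      (∀ t, slide (Box (l : ℕ∞)) (smashFin (l : ℕ∞) n lam S T) (r + c + t) = (r, c + t)) := by
  set U := smashFin (l : ℕ∞) n lam S T with hU
  have hUin : ∀ i j, j < lam i → U (i, j) = S (i, j) := by
    intro i j h
    have : i < l := by
      by_contra h'
      have := hrows i (by omega)
      omega
    simp [hU, smashFin, box_iff', this, h]
  have hUout : ∀ i j, i < l → lam i ≤ j → U (i, j) = T (i, j - lam i) + n := by
    intro i j hi h
    simp [hU, smashFin, box_iff', hi, not_lt.2 h]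
  have hl : ∀ i j, j < lam i → i < l := by
    intro i j h
    by_contra h'
    have := hrows i (by omega)
    omega
  have hpos : ∀ i j, i < l → 0 < T (i, j) := fun i j h => hT.pos _ ((box_iff' _ _ _).2 h)
  let good : ℕ → Prop := fun m =>
    slide (Box (l : ℕ∞)) U m = slide (YBox lam) S m ∧ YBox lam (slide (YBox lam) S m) ∧
        (slide (YBox lam) S m).1 + (slide (YBox lam) S m).2 = m ∧ m + 1 ≤ S (slide (YBox lam) S m)
  have anti : Antitone lam := antitone_nat_of_succ_le hpart.antitone
  have g0 : good 0 := by
    obtain ⟨⟨i, j⟩, hb, -⟩ := hS.surj 1 le_rfl hn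
    have h1 : YBox lam (0, 0) := by
      have := anti (Nat.zero_le i)
      rw [ybox_iff'] at *
      omega
    refine ⟨rfl, h1, rfl, hS.lb _ h1⟩
  have gstep : ∀ m i j, good m → slide (YBox lam) S m = (i, j) →
      (YBox lam (i + 1, j) ∨ YBox lam (i, j + 1)) → good (m + 1) := by
    intro m i j ⟨g1, g2, g3, g4⟩ hp hor
    rw [hp] at g1 g2 g3 g4
    have hr := hS.row_lt (i, j)
    have hc := hS.col_lt (i, j)
    have hru := hS.ub (i, j + 1)
    have hcu := hS.ub (i + 1, j)
    have hi : i < l := hl i j g2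
    have e1 := slide_succ' _ _ _ _ _ hp
    have e2 := slide_succ' _ _ _ _ _ g1
    simp only [ybox_iff'] at e1 g2 hor hr hc hru hcu
    simp only [box_iff', hi, and_true, if_true] at e2
    by_cases hb : j < lam (i + 1)
    · have hi1 := hl _ _ hb
      have u1 := hUin _ _ hb
      by_cases hd : j + 1 < lam i
      · have u2 := hUin _ _ hd
        by_cases hlt : S (i + 1, j) < S (i, j + 1)
        · simp only [hb, hd, hi1, u1, u2, hlt, and_self, if_true] at e1 e2
          refine ⟨by rw [e1, e2], ?_, ?_, ?_⟩ <;> rw [e1]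
          · exact hb
          · simp only at g3 ⊢; omega
          · have := hc hb; omega
        · simp only [hb, hd, hi1, u1, u2, hlt, and_self, if_true, if_false] at e1 e2
          refine ⟨by rw [e1, e2], ?_, ?_, ?_⟩ <;> rw [e1]
          · exact hd
          · simp only at g3 ⊢; omega
          · have := hr hd; omega
      · have u2 := hUout i (j + 1) hi (by omega)
        have hlt : S (i + 1, j) < T (i, j + 1 - lam i) + n := by
          have := hcu hb
          have := hpos i (j + 1 - lam i) hi
          omega
        simp only [hb, hd, hi1, u1, u2, hlt, and_false, if_true, if_false] at e1 e2
        refine ⟨by rw [e1, e2], ?_, ?_, ?_⟩ <;> rw [e1]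
        · exact hb
        · simp only at g3 ⊢; omega
        · have := hc hb; omega
    · have hd : j + 1 < lam i := by tauto
      have u2 := hUin _ _ hd
      have e2' : slide (Box (l : ℕ∞)) U (m + 1) = (i, j + 1) := by
        rw [e2]
        by_cases hi1 : i + 1 < l
        · have u1 := hUout (i + 1) j hi1 (by omega)
          have := hru hd
          rw [if_pos hi1, if_neg (by omega)]
        · simp [hi1]
      simp only [hb, hd, false_and, if_true, if_false] at e1
      refine ⟨by rw [e1, e2'], ?_, ?_, ?_⟩ <;> rw [e1]
      · exact hd
      · simp only at g3 ⊢; omega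
      · have := hr hd; omega
  have hex : ∃ m, ¬ good m := by
    refine ⟨n, fun h => ?_⟩
    have := hS.ub _ h.2.1
    have := h.2.2.2
    omega
  obtain ⟨k, hk⟩ : ∃ k, Nat.find hex = k + 1 := by
    refine Nat.exists_eq_succ_of_ne_zero fun h => ?_
    have := Nat.find_spec hex
    rw [h] at this
    exact this g0
  have hgood : ∀ m ≤ k, good m := fun m hm => by
    have := Nat.find_min hex (m := m) (by omega)
    exact not_not.1 this
  have hbad : ¬ good (k + 1) := hk ▸ Nat.find_spec hex
  obtain ⟨⟨r, c⟩, hp⟩ : ∃ b, slide (YBox lam) S k = b := ⟨_, rfl⟩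
  have hterm : ¬ (YBox lam (r + 1, c) ∨ YBox lam (r, c + 1)) :=
    fun h => hbad (gstep k r c (hgood k le_rfl) hp h)
  rw [not_or] at hterm
  obtain ⟨k1, k2, k3, k4⟩ := hgood k le_rfl
  rw [hp] at k1 k2 k3 k4
  have kub := hS.ub _ k2
  simp only [ybox_iff'] at hterm k2
  simp only at k3
  subst k3
  have hr : r < l := hl _ _ k2
  refine ⟨r, c, by omega, hr, by omega, by omega, fun m hm => ?_, fun t => ?_, fun t => ?_⟩
  · obtain ⟨a, b, c, -⟩ := hgood m hm
    exact ⟨a, b, c⟩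
  · induction t with
    | zero => exact hp
    | succ t ih =>
      rw [← add_assoc, slide_succ' _ _ _ _ _ ih]
      simp [ybox_iff', hterm.1, hterm.2]
  · induction t with
    | zero => exact k1
    | succ t ih =>
      rw [← add_assoc, slide_succ' _ _ _ _ _ ih]
      simp only [box_iff', hr, and_true, if_true]
      by_cases hi1 : r + 1 < l
      · have u1 := hUout (r + 1) (c + t) hi1 (by omega)
        have u2 := hUout r (c + t + 1) hr (by omega)
        have e : c + t + 1 - lam r = t := by omega
        rw [e] at u2
        have h1 := syt_mono l T hT (r + 1) hi1 t (c + t - lam (r + 1)) (by omega)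
        have h2 := hT.col_lt (r, t) ((box_iff' _ _ _).2 hi1)
        simp only at h2
        rw [if_pos hi1, if_neg (by omega)]
        rfl
      · simp [hi1, add_assoc]

/-- `jdt (S ◁ T) = jdt(S) ◁ T`: jeu de taquin on the left smash of a finite
standard Young tableau `S` of shape `lam ⊢ n` (with at most `l` rows) with an
infinite tableau `T ∈ SYT((∞^l))` equals the left smash of the finite jeu de
taquin of `S` (whose shape is `lam` with the terminal box of the sliding path of
`S` removed, a partition of `n - 1`) with `T`. -/
theorem stmt_7 (n l : ℕ) (hn : 1 ≤ n) (hl : 1 ≤ l) (lam : ℕ → ℕ)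
    (hpart : IsPartition lam n) (hrows : ∀ i : ℕ, l ≤ i → lam i = 0)
    (S : ℕ × ℕ → ℕ) (hS : IsFinSYT lam n S)
    (T : ℕ × ℕ → ℕ) (hT : IsSYT (l : ℕ∞) T) :
    jdt (Box (l : ℕ∞)) (smashFin (l : ℕ∞) n lam S T) =
      smashFin (l : ℕ∞) (n - 1)
        (fun i => if i = (slide (YBox lam) S n).1 then lam i - 1 else lam i)
        (jdt (YBox lam) S) T := by
  obtain ⟨r, c, hrc, hr, hc, hlam, hA, hB, hC⟩ := path_struct n l hn lam hpart hrows S hS T hT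
  have hpn : slide (YBox lam) S n = (r, c) := by
    have := hB (n - (r + c))
    rwa [Nat.add_sub_cancel' hrc.le] at this
  rw [hpn]
  have hl' : ∀ i j, j < lam i → i < l := by
    intro i j h
    by_contra h'
    have := hrows i (by omega)
    omega
  set U := smashFin (l : ℕ∞) n lam S T with hU
  have hUin : ∀ i j, j < lam i → U (i, j) = S (i, j) := by
    intro i j h
    simp [hU, smashFin, box_iff', hl' i j h, h]
  have hUout : ∀ i j, i < l → lam i ≤ j → U (i, j) = T (i, j - lam i) + n := by
    intro i j hi h
    simp [hU, smashFin, box_iff', hi, not_lt.2 h]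
  have hUbad : ∀ i j, ¬ i < l → U (i, j) = 0 := by
    intro i j hi
    simp [hU, smashFin, box_iff', hi]
  funext ⟨i, j⟩
  -- rows beyond the path
  by_cases hm : i + j < r + c
  · -- before the terminal box
    obtain ⟨a1, a2, a3⟩ := hA (i + j) hm.le
    obtain ⟨b1, b2, b3⟩ := hA (i + j + 1) hm
    by_cases hon : slide (YBox lam) S (i + j) = (i, j)
    · have hne : slide (YBox lam) S (i + j + 1) ≠ (i, j) := by
        intro h
        rw [h] at b3
        simp only at b3
        omega
      rw [hon] at a2
      rw [ybox_iff'] at a2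
      have hi := hl' _ _ a2
      have hj : j < (if i = r then lam i - 1 else lam i) := by
        split_ifs with h
        · subst h; omega
        · exact a2
      simp only [jdt, smashFin, a1, b1, hon, hne, box_iff', hi, hj, if_true, if_false]
      rw [← Prod.mk.eta (p := slide (YBox lam) S (i + j + 1)), hUin _ _ b2]
    · by_cases hi : i < l
      · by_cases hj : j < lam i
        · have hj' : j < (if i = r then lam i - 1 else lam i) := by
            split_ifs with h
            · subst h; omega
            · exact hj
          simp only [jdt, smashFin, a1, hon, box_iff', hi, hj', if_true, if_false, hUin i j hj]
        · have hir : i ≠ r := by rintro rfl; omega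
          have := hUout i j hi (by omega)
          simp only [jdt, smashFin, a1, hon, box_iff', hi, hj, hir, if_true, if_false, this]
          omega
      · simp only [jdt, smashFin, a1, hon, box_iff', hi, if_false, hUbad i j hi]
  · obtain ⟨t, ht⟩ := Nat.exists_eq_add_of_le (not_lt.1 hm)
    have c1 := hC t
    have c2 := hC (t + 1)
    have d1 := hB t
    have d2 := hB (t + 1)
    rw [← add_assoc, ← ht] at c2 d2
    rw [← ht] at c1 d1
    by_cases hir : i = r
    · subst hir
      have hj : j = c + t := by omega
      subst hj
      have u := hUout i (c + t + 1) hr (by omega)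
      have e : c + t + 1 - lam i = t := by omega
      have e' : c + t - (lam i - 1) = t := by omega
      have e'' : ¬ c + t < lam i - 1 := by omega
      have hne : (i, c + (t + 1)) ≠ (i, c + t) := by simp
      rw [e] at u
      simp only [jdt, smashFin, c1, c2, box_iff', hr, hne, if_true, if_false, e', e'']
      rw [← add_assoc, u]
      omega
    · have n1 : (r, c + t) ≠ (i, j) := by
        intro h; exact hir (Prod.ext_iff.1 h).1.symm
      have n2 : (r, c) ≠ (i, j) := by
        intro h; exact hir (Prod.ext_iff.1 h).1.symm
      by_cases hi : i < l
      · by_cases hj : j < lam i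
        · simp only [jdt, smashFin, c1, d1, n1, n2, hir, box_iff', hi, hj, if_true, if_false, hUin i j hj]
        · have := hUout i j hi (by omega)
          simp only [jdt, smashFin, c1, n1, box_iff', hi, hj, hir, if_true, if_false, this]
          omega
      · simp only [jdt, smashFin, c1, n1, box_iff', hi, if_false, hUbad i j hi]
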